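/- Assume (H1), (H2), (H3), and (H5). Then for every κ > 0 the sublevel set {γ ∈ Γ : L(γ) ≤ κ} is compact in Γ (for the topology of uniform convergence on compact time intervals), where L(γ) = ∫₀^∞ ℓ(t,γ(t),γ̇(t)) dt + Ψ(τ(γ)) if γ is absolutely continuous and L(γ) = +∞ otherwise. -/

import Mathlib

open MeasureTheory Filter Topology Set
open scoped ENNReal NNReal

noncomputable section

/-- Euclidean space `ℝ^d`. -/
abbrev EucSp (d : ℕ) := EuclideanSpace ℝ (Fin d)

/-- The space `Γ = C(ℝ₊, Ω̄)` of continuous curves with values in `closure Ω`, endowed with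
the topology of uniform convergence on compact time intervals (the compact-open topology). -/
abbrev CurveSp {d : ℕ} (Ω : Set (EucSp d)) :=
  {γ : C(ℝ≥0, EucSp d) // ∀ t : ℝ≥0, γ t ∈ closure Ω}

variable {d : ℕ}

/-- `γ` is absolutely continuous with (locally integrable) velocity `g`. -/
def HasVel {Ω : Set (EucSp d)} (γ : CurveSp Ω) (g : ℝ → EucSp d) : Prop :=
  (∀ T : ℝ, IntegrableOn g (Set.Icc 0 T) volume) ∧
    ∀ t : ℝ≥0, γ.1 t = γ.1 0 + ∫ s in Set.Ioc (0 : ℝ) (t : ℝ), g s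

/-- The first exit time `τ(γ) = inf {t ≥ 0 | γ(t) ∈ Ξ}`, with value `+∞` if `γ` never
reaches `Ξ`. -/
def exitT {Ω : Set (EucSp d)} (Ξ : Set (EucSp d)) (γ : CurveSp Ω) : ℝ≥0∞ :=
  ⨅ (t : ℝ≥0) (_ : γ.1 t ∈ Ξ), (t : ℝ≥0∞)

/-- The extension of a nondecreasing `Ψ : ℝ₊ → ℝ₊` to `[0,+∞]`: for finite `T` it coincides
with `Ψ(T)` (as `Ψ` is nondecreasing), and `Ψ(+∞) = sup Ψ`. -/
def PsiExt (Ψ : ℝ → ℝ) (T : ℝ≥0∞) : ℝ≥0∞ :=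
  ⨆ (t : ℝ≥0) (_ : (t : ℝ≥0∞) ≤ T), ENNReal.ofReal (Ψ (t : ℝ))

/-- The individual cost `L(γ) = ∫₀^∞ ℓ(t,γ(t),γ̇(t)) dt + Ψ(τ(γ))` if `γ` is absolutely
continuous, and `L(γ) = +∞` otherwise (the infimum over an empty family is `+∞`; any two
velocities of `γ` agree a.e., so the infimum is the common value of the integral). -/
def Lcost {Ω : Set (EucSp d)} (ℓ : ℝ → EucSp d → EucSp d → ℝ) (Ψ : ℝ → ℝ)
    (Ξ : Set (EucSp d)) (γ : CurveSp Ω) : ℝ≥0∞ :=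
  (⨅ (g : ℝ → EucSp d) (_ : HasVel γ g),
    ∫⁻ t in Set.Ioi (0 : ℝ), ENNReal.ofReal (ℓ t (γ.1 t.toNNReal) (g t))) +
  PsiExt Ψ (exitT Ξ γ)

/-- The raw pairwise interaction cost
`∫₀^{τ(γ) ∧ τ(γ̃)} h(t,γ(t),γ̃(t),γ̇(t),γ̃̇(t)) dt`, equal to `+∞` when one of the curves is
not absolutely continuous. -/
def interCost {Ω : Set (EucSp d)}
    (h : ℝ → EucSp d → EucSp d → EucSp d → EucSp d → ℝ)
    (Ξ : Set (EucSp d)) (γ γ' : CurveSp Ω) : ℝ≥0∞ :=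
  ⨅ (g : ℝ → EucSp d) (_ : HasVel γ g) (g' : ℝ → EucSp d) (_ : HasVel γ' g'),
    ∫⁻ t in {t : ℝ | 0 < t ∧ ENNReal.ofReal t < min (exitT Ξ γ) (exitT Ξ γ')},
      ENNReal.ofReal (h t (γ.1 t.toNNReal) (γ'.1 t.toNNReal) (g t) (g' t))

/-- The interaction cost `H(γ,γ̃)`, equal to the raw interaction cost when
`L(γ) < +∞` and `L(γ̃) < +∞`, and to `+∞` otherwise. -/
def Hcost {Ω : Set (EucSp d)} (ℓ : ℝ → EucSp d → EucSp d → ℝ) (Ψ : ℝ → ℝ)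
    (h : ℝ → EucSp d → EucSp d → EucSp d → EucSp d → ℝ)
    (Ξ : Set (EucSp d)) (γ γ' : CurveSp Ω) : ℝ≥0∞ :=
  if Lcost ℓ Ψ Ξ γ ≠ ⊤ ∧ Lcost ℓ Ψ Ξ γ' ≠ ⊤ then interCost h Ξ γ γ' else ⊤

instance {Ω : Set (EucSp d)} : MeasurableSpace (CurveSp Ω) := borel _
instance {Ω : Set (EucSp d)} : BorelSpace (CurveSp Ω) := ⟨rfl⟩

/-- The total cost `F(γ,Q)` from the mean field game, with the conventions of the paper:
`F(γ,Q) = +∞` if `γ` is not absolutely continuous, if `Q` gives positive measure to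
non-absolutely-continuous curves, or if the inner interaction integral is not `Q`-integrable. -/
def F1cost {Ω : Set (EucSp d)} (ℓ : ℝ → EucSp d → EucSp d → ℝ) (Ψ : ℝ → ℝ)
    (h : ℝ → EucSp d → EucSp d → EucSp d → EucSp d → ℝ)
    (Ξ : Set (EucSp d)) (γ : CurveSp Ω) (Q : Measure (CurveSp Ω)) : ℝ≥0∞ :=
  if Q {γ' : CurveSp Ω | ¬ ∃ g : ℝ → EucSp d, HasVel γ' g} = 0 then
    Lcost ℓ Ψ Ξ γ + ∫⁻ γ', interCost h Ξ γ γ' ∂Q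
  else ⊤

/-- The total cost `F(γ,Q) = L(γ) + ∫ H(γ,·) dQ` of the associated abstract non-atomic game. -/
def F2cost {Ω : Set (EucSp d)} (ℓ : ℝ → EucSp d → EucSp d → ℝ) (Ψ : ℝ → ℝ)
    (h : ℝ → EucSp d → EucSp d → EucSp d → EucSp d → ℝ)
    (Ξ : Set (EucSp d)) (γ : CurveSp Ω) (Q : Measure (CurveSp Ω)) : ℝ≥0∞ :=
  Lcost ℓ Ψ Ξ γ + ∫⁻ γ', Hcost ℓ Ψ h Ξ γ γ' ∂Q

/-- The geodesic (intrinsic) distance in `S`: the infimum of the lengths (total variations)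
of continuous paths in `S` joining `x` to `y`. -/
def geoDist {d : ℕ} (S : Set (EucSp d)) (x y : EucSp d) : ℝ≥0∞ :=
  ⨅ (f : ℝ → EucSp d) (_ : ContinuousOn f (Set.Icc 0 1))
    (_ : ∀ t ∈ Set.Icc (0 : ℝ) 1, f t ∈ S) (_ : f 0 = x) (_ : f 1 = y),
    eVariationOn f (Set.Icc 0 1)


/-- The weights of convex combinations supported on the indices `n ≥ N`. -/
def tailWeights (N : ℕ) : Set (ℕ →₀ ℝ) :=
  {c | (∀ n, 0 ≤ c n) ∧ (∀ n < N, c n = 0) ∧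
    Finsupp.linearCombination ℝ (fun _ : ℕ => (1 : ℝ)) c = 1}

lemma convex_tailWeights (N : ℕ) : Convex ℝ (tailWeights N) := by
  rintro c ⟨hc, hc', hc1⟩ e ⟨he, he', he1⟩ a b ha hb hab
  refine ⟨fun n => ?_, fun n hn => ?_, ?_⟩
  · have := mul_nonneg ha (hc n)
    have := mul_nonneg hb (he n)
    simp only [Finsupp.add_apply, Finsupp.smul_apply, smul_eq_mul]
    linarith
  · simp [hc' n hn, he' n hn]
  · rw [map_add, map_smul, map_smul, hc1, he1]
    simpa using hab

lemma single_mem_tailWeights (N : ℕ) : Finsupp.single N 1 ∈ tailWeights N := by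
  refine ⟨fun n => ?_, fun n hn => ?_, by simp⟩
  · rw [Finsupp.single_apply]
    split_ifs <;> norm_num
  · rw [Finsupp.single_apply, if_neg hn.ne']

lemma tailWeights_antitone : Antitone tailWeights :=
  fun _ _ h _ hc => ⟨hc.1, fun n hn => hc.2.1 n (hn.trans_le h), hc.2.2⟩

lemma sum_eq_one_of_mem_tailWeights {N : ℕ} {c : ℕ →₀ ℝ} (hc : c ∈ tailWeights N) :
    ∑ n ∈ c.support, c n = 1 := by
  simpa [Finsupp.linearCombination_apply, Finsupp.sum] using hc.2.2

lemma le_of_mem_support_of_mem_tailWeights {N n : ℕ} {c : ℕ →₀ ℝ} (hc : c ∈ tailWeights N)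
    (hn : n ∈ c.support) : N ≤ n := by
  by_contra! h
  exact Finsupp.mem_support_iff.1 hn (hc.2.1 n h)

/-- A convex combination of the tail of a sequence stays within any distance bounding the tail. -/
lemma norm_linearCombination_sub_le {X : Type*} [SeminormedAddCommGroup X] [NormedSpace ℝ X]
    {N : ℕ} {c : ℕ →₀ ℝ} (hc : c ∈ tailWeights N) {x y : ℕ → X} {r : ℝ}
    (h : ∀ n ≥ N, ‖x n - y n‖ ≤ r) :
    ‖Finsupp.linearCombination ℝ x c - Finsupp.linearCombination ℝ y c‖ ≤ r := by
  simp only [Finsupp.linearCombination_apply, Finsupp.sum]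
  rw [← Finset.sum_sub_distrib]
  calc ‖∑ n ∈ c.support, (c n • x n - c n • y n)‖
      ≤ ∑ n ∈ c.support, c n * r := by
        refine norm_sum_le_of_le _ fun n hn => ?_
        rw [← smul_sub, norm_smul, Real.norm_of_nonneg (hc.1 n)]
        exact mul_le_mul_of_nonneg_left
          (h n (le_of_mem_support_of_mem_tailWeights hc hn)) (hc.1 n)
    _ = r := by rw [← Finset.sum_mul, sum_eq_one_of_mem_tailWeights hc, one_mul]

lemma linearCombination_const_of_mem_tailWeights {X : Type*} [AddCommGroup X] [Module ℝ X]
    {N : ℕ} {c : ℕ →₀ ℝ} (hc : c ∈ tailWeights N) (x : X) :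
    Finsupp.linearCombination ℝ (fun _ => x) c = x := by
  simp only [Finsupp.linearCombination_apply, Finsupp.sum]
  rw [← Finset.sum_smul, sum_eq_one_of_mem_tailWeights hc, one_smul]

lemma tendsto_linearCombination_of_tailWeights {X : Type*} [SeminormedAddCommGroup X]
    [NormedSpace ℝ X] {c : ℕ → ℕ →₀ ℝ} (hc : ∀ N, c N ∈ tailWeights N) {x : ℕ → X} {l : X}
    (h : Tendsto x atTop (𝓝 l)) :
    Tendsto (fun N => Finsupp.linearCombination ℝ x (c N)) atTop (𝓝 l) := by
  rw [Metric.tendsto_atTop] at h ⊢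
  intro ε hε
  obtain ⟨N, hN⟩ := h (ε / 2) (half_pos hε)
  refine ⟨N, fun M hM => ?_⟩
  rw [dist_eq_norm, ← linearCombination_const_of_mem_tailWeights (hc M) l]
  refine (norm_linearCombination_sub_le (hc M) (r := ε / 2) fun n hn => ?_).trans_lt
    (half_lt_self hε)
  rw [← dist_eq_norm]
  exact (hN n (hM.trans hn)).le

/-- A bounded sequence in a Hilbert space has Cauchy forward convex combinations. -/
lemma exists_tailWeights_cauchySeq {H : Type*} [NormedAddCommGroup H] [InnerProductSpace ℝ H]
    [CompleteSpace H] {x : ℕ → H} {R : ℝ} (hx : ∀ n, ‖x n‖ ≤ R) :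
    ∃ c : ℕ → ℕ →₀ ℝ, (∀ N, c N ∈ tailWeights N) ∧
      CauchySeq fun N => Finsupp.linearCombination ℝ x (c N) := by
  set K : ℕ → Set H := fun N => closure (Finsupp.linearCombination ℝ x '' tailWeights N) with hK
  have hKconv : ∀ N, Convex ℝ (K N) := fun N =>
    ((convex_tailWeights N).linear_image _).closure
  have hxK : ∀ N, x N ∈ K N := fun N =>
    subset_closure ⟨_, single_mem_tailWeights N, by simp⟩
  have hKanti : ∀ {M N}, N ≤ M → K M ⊆ K N := fun h =>
    closure_mono (image_mono (tailWeights_antitone h))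
  have hmin : ∀ N, ∃ y ∈ K N, ∀ z ∈ K N, ‖y‖ ^ 2 + ‖z - y‖ ^ 2 ≤ ‖z‖ ^ 2 := by
    intro N
    obtain ⟨y, hy, h⟩ := exists_norm_eq_iInf_of_complete_convex ⟨_, hxK N⟩
      (isClosed_closure.isComplete) (hKconv N) 0
    refine ⟨y, hy, fun z hz => ?_⟩
    have h1 := (norm_eq_iInf_iff_real_inner_le_zero (hKconv N) hy).1 h z hz
    have h2 := norm_add_sq_real y (z - y)
    rw [add_sub_cancel] at h2
    rw [zero_sub, inner_neg_left] at h1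
    linarith
  choose y hyK hy using hmin
  have hmono : Monotone fun N => ‖y N‖ ^ 2 := fun N M h => by
    have := hy N _ (hKanti h (hyK M))
    have := sq_nonneg ‖y M - y N‖
    simp only
    linarith
  have hbdd : BddAbove (range fun N => ‖y N‖ ^ 2) := by
    refine ⟨R ^ 2, ?_⟩
    rintro _ ⟨N, rfl⟩
    have h1 := hy N _ (hxK N)
    have h2 := sq_nonneg ‖x N - y N‖
    have h3 := pow_le_pow_left₀ (norm_nonneg _) (hx N) 2
    simp only
    linarith
  have hycauchy : CauchySeq y := by
    have hc := (tendsto_atTop_ciSup hmono hbdd).cauchySeq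
    rw [Metric.cauchySeq_iff'] at hc ⊢
    intro ε hε
    obtain ⟨N, hN⟩ := hc (ε ^ 2) (by positivity)
    refine ⟨N, fun M hM => ?_⟩
    have h1 := hN M hM
    have h2 := hy N _ (hKanti hM (hyK M))
    rw [Real.dist_eq] at h1
    rw [dist_eq_norm]
    refine lt_of_pow_lt_pow_left₀ 2 hε.le ?_
    have := le_abs_self (‖y M‖ ^ 2 - ‖y N‖ ^ 2)
    linarith
  have happrox : ∀ N, ∃ c ∈ tailWeights N,
      dist (y N) (Finsupp.linearCombination ℝ x c) < 1 / ((N : ℝ) + 1) := by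
    intro N
    obtain ⟨_, ⟨c, hc, rfl⟩, h⟩ := Metric.mem_closure_iff.1 (hyK N) (1 / ((N : ℝ) + 1))
      Nat.one_div_pos_of_nat
    exact ⟨c, hc, h⟩
  choose c hc hcy using happrox
  refine ⟨c, hc, ?_⟩
  obtain ⟨l, hl⟩ := cauchySeq_tendsto_of_complete hycauchy
  refine (hl.congr_dist ?_).cauchySeq
  exact squeeze_zero (fun _ => dist_nonneg) (fun N => (hcy N).le)
    tendsto_one_div_add_atTop_nhds_zero_nat

/-- Countably many bounded sequences in a Hilbert space have simultaneous Cauchy forward convex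
combinations. -/
lemma exists_tailWeights_forall_cauchySeq {H : Type*} [NormedAddCommGroup H]
    [InnerProductSpace ℝ H] [CompleteSpace H] {x : ℕ → ℕ → H} {R : ℕ → ℝ}
    (hx : ∀ k n, ‖x k n‖ ≤ R k) :
    ∃ c : ℕ → ℕ →₀ ℝ, (∀ N, c N ∈ tailWeights N) ∧
      ∀ k, CauchySeq fun N => Finsupp.linearCombination ℝ (x k) (c N) := by
  have hR : ∀ k, 0 ≤ R k := fun k => (norm_nonneg _).trans (hx k 0)
  set w : ℕ → ℝ := fun k => (1 / 2) ^ k / (R k + 1) with hw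
  have hwpos : ∀ k, 0 < w k := fun k => by have := hR k; positivity
  have hwx : ∀ k n, ‖w k • x k n‖ ^ (2 : ℝ≥0∞).toReal ≤ (1 / 4 : ℝ) ^ k := by
    intro k n
    have h1 : ‖w k • x k n‖ ≤ (1 / 2) ^ k := by
      rw [norm_smul, Real.norm_of_nonneg (hwpos k).le, hw]
      simp only
      rw [div_mul_eq_mul_div, div_le_iff₀ (by have := hR k; positivity)]
      have := hx k n
      gcongr
      linarith
    rw [ENNReal.toReal_ofNat, Real.rpow_two]
    calc ‖w k • x k n‖ ^ 2 ≤ ((1 / 2 : ℝ) ^ k) ^ 2 := by gcongr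
      _ = (1 / 4 : ℝ) ^ k := by rw [← pow_mul, mul_comm, pow_mul]; norm_num
  have hsum : Summable fun k : ℕ => (1 / 4 : ℝ) ^ k :=
    summable_geometric_of_lt_one (by norm_num) (by norm_num)
  have hmem : ∀ n, Memℓp (fun k => w k • x k n) 2 := fun n =>
    memℓp_gen (hsum.of_nonneg_of_le (fun k => by positivity) fun k => hwx k n)
  let G : ℕ → lp (fun _ : ℕ => H) 2 := fun n => ⟨fun k => w k • x k n, hmem n⟩
  have hG : ∀ n, ‖G n‖ ≤ 2 := by
    intro n
    refine lp.norm_le_of_tsum_le (by norm_num) (by norm_num) ?_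
    refine (((lp.memℓp (G n)).summable (by norm_num)).tsum_le_tsum
      (fun k => hwx k n) hsum).trans ?_
    rw [tsum_geometric_of_lt_one (by norm_num) (by norm_num)]
    norm_num
  obtain ⟨c, hc, hcau⟩ := exists_tailWeights_cauchySeq hG
  refine ⟨c, hc, fun k => ?_⟩
  have hcoord : ∀ N, Finsupp.linearCombination ℝ G (c N) k =
      w k • Finsupp.linearCombination ℝ (x k) (c N) := by
    intro N
    simp only [Finsupp.linearCombination_apply, Finsupp.sum, lp.coeFn_sum, Finset.sum_apply,
      Finset.smul_sum, lp.coeFn_smul, Pi.smul_apply]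
    exact Finset.sum_congr rfl fun n _ => smul_comm _ _ _
  rw [Metric.cauchySeq_iff'] at hcau ⊢
  intro ε hε
  obtain ⟨N, hN⟩ := hcau (w k * ε) (mul_pos (hwpos k) hε)
  refine ⟨N, fun M hM => ?_⟩
  have h1 := (lp.norm_apply_le_norm two_ne_zero
    (Finsupp.linearCombination ℝ G (c M) - Finsupp.linearCombination ℝ G (c N)) k).trans_lt
    ((dist_eq_norm _ _).symm.trans_lt (hN M hM))
  rw [lp.coeFn_sub, Pi.sub_apply, hcoord, hcoord, ← smul_sub, norm_smul,
    Real.norm_of_nonneg (hwpos k).le] at h1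
  rw [dist_eq_norm]
  exact lt_of_mul_lt_mul_left h1 (hwpos k).le

/-- If a sequence can be approximated uniformly by sequences whose convex combinations are Cauchy,
then its convex combinations are Cauchy. -/
lemma cauchySeq_linearCombination_of_approx {X : Type*} [SeminormedAddCommGroup X]
    [NormedSpace ℝ X] {c : ℕ → ℕ →₀ ℝ} (hc : ∀ N, c N ∈ tailWeights N) {x : ℕ → X}
    {y : ℕ → ℕ → X} {r : ℕ → ℝ} (hr : Tendsto r atTop (𝓝 0)) (hxy : ∀ k n, ‖x n - y k n‖ ≤ r k)
    (hy : ∀ k, CauchySeq fun N => Finsupp.linearCombination ℝ (y k) (c N)) :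
    CauchySeq fun N => Finsupp.linearCombination ℝ x (c N) := by
  rw [Metric.cauchySeq_iff']
  intro ε hε
  obtain ⟨k, hk⟩ := (hr.eventually_lt_const (show 0 < ε / 3 by positivity)).exists
  obtain ⟨N, hN⟩ := Metric.cauchySeq_iff'.1 (hy k) (ε / 3) (by positivity)
  refine ⟨N, fun M hM => ?_⟩
  have h1 := norm_linearCombination_sub_le (hc M) fun n _ => hxy k n
  have h2 := norm_linearCombination_sub_le (hc N) fun n _ => hxy k n
  have h3 := hN M hM
  have h4 := dist_triangle4 (Finsupp.linearCombination ℝ x (c M))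
    (Finsupp.linearCombination ℝ (y k) (c M)) (Finsupp.linearCombination ℝ (y k) (c N))
    (Finsupp.linearCombination ℝ x (c N))
  rw [← dist_eq_norm] at h1 h2
  rw [dist_comm] at h2
  linarith

lemma le_rpow_one_sub_mul_rpow {M x θ : ℝ} (hM : 0 < M) (hθ : 1 < θ) (h : M < x) :
    x ≤ M ^ (1 - θ) * x ^ θ := by
  have hx : 0 < x := hM.trans h
  calc x = x ^ (1 - θ) * x ^ θ := by rw [← Real.rpow_add hx]; simp
    _ ≤ M ^ (1 - θ) * x ^ θ := by
        gcongr ?_ * _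
        exact Real.rpow_le_rpow_of_nonpos hM h.le (by linarith)

lemma coeFn_linearCombination_toLp {A E : Type*} {mA : MeasurableSpace A} {μ : Measure A}
    [NormedAddCommGroup E] [NormedSpace ℝ E] {p : ℝ≥0∞} {f : ℕ → A → E}
    (hf : ∀ n, MemLp (f n) p μ) (c : ℕ →₀ ℝ) :
    Finsupp.linearCombination ℝ (fun n => (hf n).toLp (f n)) c =ᵐ[μ]
      Finsupp.linearCombination ℝ f c := by
  induction c using Finsupp.induction_linear with
  | zero => simpa using Lp.coeFn_zero E p μ
  | add c e hc he =>
    rw [map_add, map_add]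
    exact (Lp.coeFn_add _ _).trans (hc.add he)
  | single n r =>
    rw [Finsupp.linearCombination_single, Finsupp.linearCombination_single]
    exact (Lp.coeFn_smul _ _).trans ((hf n).coeFn_toLp.const_smul r)

/-- The inclusion of `L²` in `L¹` for a finite measure. -/
def inclusionL2L1 {A : Type*} (E : Type*) {mA : MeasurableSpace A} (μ : Measure A)
    [IsFiniteMeasure μ] [NormedAddCommGroup E] [NormedSpace ℝ E] :
    Lp E 2 μ →ₗ[ℝ] Lp E 1 μ where
  toFun f := ⟨f.1, Lp.antitone one_le_two f.2⟩
  map_add' _ _ := rfl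
  map_smul' _ _ := rfl

lemma uniformContinuous_inclusionL2L1 {A : Type*} (E : Type*) {mA : MeasurableSpace A}
    (μ : Measure A) [IsFiniteMeasure μ] [NormedAddCommGroup E] [NormedSpace ℝ E] :
    UniformContinuous (inclusionL2L1 E μ) := by
  refine AddMonoidHomClass.uniformContinuous_of_bound (inclusionL2L1 E μ)
    ((μ univ ^ (1 / 2 : ℝ)).toReal) fun f => ?_
  have h := eLpNorm_le_eLpNorm_mul_rpow_measure_univ (μ := μ) (p := 1) (q := 2) one_le_two
    (Lp.aestronglyMeasurable f)
  have h2 := ENNReal.toReal_mono (ENNReal.mul_ne_top (Lp.eLpNorm_ne_top f)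
    (ENNReal.rpow_ne_top_of_nonneg (by norm_num) (measure_ne_top μ univ))) h
  rw [ENNReal.toReal_mul, mul_comm] at h2
  norm_num at h2
  norm_num
  exact h2

/-- A sequence bounded in `L^θ`, `θ > 1`, over a finite measure has forward convex combinations
converging almost everywhere and in `L¹`. -/
lemma exists_tailWeights_tendsto {A E : Type*} {mA : MeasurableSpace A} {μ : Measure A}
    [IsFiniteMeasure μ] [NormedAddCommGroup E] [InnerProductSpace ℝ E] [CompleteSpace E]
    {θ : ℝ} (hθ : 1 < θ) {g : ℕ → A → E} (hg : ∀ n, AEStronglyMeasurable (g n) μ)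
    {C : ℝ≥0} (hC : ∀ n, ∫⁻ t, ENNReal.ofReal (‖g n t‖ ^ θ) ∂μ ≤ C) :
    ∃ (c : ℕ → ℕ →₀ ℝ) (v : A → E), (∀ N, c N ∈ tailWeights N) ∧ Integrable v μ ∧
      (∀ n, Integrable (g n) μ) ∧
      (∀ᵐ t ∂μ, Tendsto (fun N => Finsupp.linearCombination ℝ g (c N) t) atTop (𝓝 (v t))) ∧
      Tendsto (fun N => ∫⁻ t, ‖Finsupp.linearCombination ℝ g (c N) t - v t‖ₑ ∂μ) atTop (𝓝 0) := by
  let T : ℕ → ℕ → A → E := fun k n t => if ‖g n t‖ ≤ k + 1 then g n t else 0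
  have hTbd : ∀ k n t, ‖T k n t‖ ≤ k + 1 := by
    intro k n t
    simp only [T]
    split_ifs with h
    · exact h
    · rw [norm_zero]; positivity
  have hTm : ∀ k n, AEStronglyMeasurable (T k n) μ := by
    intro k n
    have hnull : NullMeasurableSet {t | ‖g n t‖ ≤ k + 1} μ :=
      nullMeasurableSet_le (hg n).norm.aemeasurable aemeasurable_const
    refine ((hg n).indicator₀ hnull).congr (ae_of_all _ fun t => ?_)
    simp only [T, indicator, mem_ofPred_eq]
  have hdiff : ∀ k n, ∫⁻ t, ‖g n t - T k n t‖ₑ ∂μ ≤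
      ENNReal.ofReal (((k : ℝ) + 1) ^ (1 - θ)) * C := by
    intro k n
    calc ∫⁻ t, ‖g n t - T k n t‖ₑ ∂μ
        ≤ ∫⁻ t, ENNReal.ofReal (((k : ℝ) + 1) ^ (1 - θ)) * ENNReal.ofReal (‖g n t‖ ^ θ) ∂μ := by
          refine lintegral_mono fun t => ?_
          simp only [T]
          split_ifs with h
          · simp
          · rw [sub_zero, ← ofReal_norm, ← ENNReal.ofReal_mul (by positivity)]
            exact ENNReal.ofReal_le_ofReal
              (le_rpow_one_sub_mul_rpow (by positivity) hθ (not_le.1 h))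
      _ = ENNReal.ofReal (((k : ℝ) + 1) ^ (1 - θ)) * ∫⁻ t, ENNReal.ofReal (‖g n t‖ ^ θ) ∂μ :=
          lintegral_const_mul' _ _ ENNReal.ofReal_ne_top
      _ ≤ _ := by gcongr; exact hC n
  have hT2 : ∀ k n, MemLp (T k n) 2 μ := fun k n =>
    MemLp.of_bound (hTm k n) _ (ae_of_all _ (hTbd k n))
  have hT1 : ∀ k n, MemLp (T k n) 1 μ := fun k n =>
    MemLp.of_bound (hTm k n) _ (ae_of_all _ (hTbd k n))
  have hg1 : ∀ n, MemLp (g n) 1 μ := by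
    intro n
    have h0 : MemLp (g n - T 0 n) 1 μ := by
      refine ⟨(hg n).sub (hTm 0 n), ?_⟩
      rw [eLpNorm_one_eq_lintegral_enorm]
      exact (hdiff 0 n).trans_lt (ENNReal.mul_lt_top ENNReal.ofReal_lt_top ENNReal.coe_lt_top)
    simpa using h0.add (hT1 0 n)
  obtain ⟨c, hc, hcau⟩ := exists_tailWeights_forall_cauchySeq
    (x := fun k n => (hT2 k n).toLp (T k n)) (fun k n => by
      refine Lp.norm_le_of_ae_bound (C := k + 1) (by positivity) ?_
      filter_upwards [(hT2 k n).coeFn_toLp] with t ht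
      rw [ht]
      exact hTbd k n t)
  have hcau1 : ∀ k, CauchySeq fun N =>
      Finsupp.linearCombination ℝ (fun n => (hT1 k n).toLp (T k n)) (c N) := by
    intro k
    have h := (uniformContinuous_inclusionL2L1 E μ).comp_cauchySeq (hcau k)
    convert h using 2 with N
    simp only [Function.comp_apply, Finsupp.linearCombination_apply, Finsupp.sum, map_sum,
      map_smul]
    rfl
  have hcauG : CauchySeq fun N =>
      Finsupp.linearCombination ℝ (fun n => (hg1 n).toLp (g n)) (c N) := by
    refine cauchySeq_linearCombination_of_approx hc
      (r := fun k => ((k : ℝ) + 1) ^ (1 - θ) * C) ?_ (fun k n => ?_) hcau1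
    · have h1 : Tendsto (fun k : ℕ => (k : ℝ) + 1) atTop atTop :=
        tendsto_atTop_add_const_right _ _ tendsto_natCast_atTop_atTop
      have h2 := (tendsto_rpow_neg_atTop (show 0 < θ - 1 by linarith)).comp h1
      simpa [neg_sub, Function.comp_def] using h2.mul_const (C : ℝ)
    · rw [← MemLp.toLp_sub, Lp.norm_toLp, eLpNorm_one_eq_lintegral_enorm]
      refine ENNReal.toReal_le_of_le_ofReal (by positivity) ?_
      rw [ENNReal.ofReal_mul (by positivity), ENNReal.ofReal_coe_nnreal]
      exact hdiff k n
  obtain ⟨v, hv⟩ := cauchySeq_tendsto_of_complete hcauG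
  have hlim : Tendsto (fun N => eLpNorm (Finsupp.linearCombination ℝ g (c N) - ⇑v) 1 μ) atTop
      (𝓝 0) := by
    refine ((Lp.tendsto_Lp_iff_tendsto_eLpNorm' _ _).1 hv).congr fun N => ?_
    exact eLpNorm_congr_ae ((coeFn_linearCombination_toLp hg1 (c N)).sub (EventuallyEq.refl _ _))
  have hmeas : ∀ N, AEStronglyMeasurable (Finsupp.linearCombination ℝ g (c N)) μ := fun N =>
    (Lp.aestronglyMeasurable _).congr (coeFn_linearCombination_toLp hg1 (c N))
  obtain ⟨ns, hns, hae⟩ := (tendstoInMeasure_of_tendsto_eLpNorm one_ne_zero hmeas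
    (Lp.aestronglyMeasurable v) hlim).exists_seq_tendsto_ae
  refine ⟨c ∘ ns, v, fun N => tailWeights_antitone (hns.le_apply) (hc _),
    memLp_one_iff_integrable.1 (Lp.memLp v), fun n => memLp_one_iff_integrable.1 (hg1 n), hae, ?_⟩
  simpa only [eLpNorm_one_eq_lintegral_enorm, Function.comp_def, Pi.sub_apply] using
    hlim.comp hns.tendsto_atTop

/-- Lower semicontinuity of convex combinations of `f`: the values at `(x n, p n)` asymptotically
dominate the value of `f` at the limit of the first components and of the convex combinations of
the second ones. -/
lemma eventually_le_linearCombination {E : Type*} [NormedAddCommGroup E] [NormedSpace ℝ E]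
    [ProperSpace E] {K : Set E} (hK : IsCompact K) {f : E → E → ℝ}
    (hf : ContinuousOn (fun q : E × E => f q.1 q.2) (K ×ˢ univ)) {y : E} (hy : y ∈ K)
    (hconv : ConvexOn ℝ univ (f y)) {α θ : ℝ} (hα : 0 < α) (hθ : 1 < θ)
    (hlb : ∀ x ∈ K, ∀ p, α * ‖p‖ ^ θ ≤ f x p) {x p : ℕ → E} (hxK : ∀ n, x n ∈ K)
    (hx : Tendsto x atTop (𝓝 y)) {c : ℕ → ℕ →₀ ℝ} (hc : ∀ N, c N ∈ tailWeights N) {v : E}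
    (hv : Tendsto (fun N => Finsupp.linearCombination ℝ p (c N)) atTop (𝓝 v)) {a : ℝ}
    (ha : a < f y v) :
    ∀ᶠ N in atTop, a ≤ Finsupp.linearCombination ℝ (fun n => f (x n) (p n)) (c N) := by
  obtain ⟨a', haa', ha'⟩ := exists_between ha
  have hcont : ∀ x ∈ K, Continuous (f x) := fun x hx =>
    hf.comp_continuous (by fun_prop : Continuous fun p : E => (x, p)) fun p => ⟨hx, mem_univ p⟩
  obtain ⟨l, k, hle, heq⟩ := hconv.exists_affine_le_of_lt (𝕜 := ℝ) (mem_univ v) ha' isClosed_univ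
    ((hcont y hy).lowerSemicontinuous.lowerSemicontinuousOn _)
  have hle' : ∀ q, l q + k ≤ f y q := fun q => by simpa using hle ⟨q, mem_univ q⟩
  have heq' : l v + k = a' := by simpa using heq
  set ε := (a' - a) / 2 with hε
  have hεpos : 0 < ε := by rw [hε]; linarith
  obtain ⟨R, hR1, hR⟩ : ∃ R : ℝ, 1 ≤ R ∧ ∀ r ≥ R, (‖l‖ + |k|) / α ≤ r ^ (θ - 1) := by
    obtain ⟨R, hR⟩ := ((tendsto_rpow_atTop (sub_pos.2 hθ)).eventually_ge_atTop
      ((‖l‖ + |k|) / α)).exists_forall_of_atTop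
    exact ⟨max R 1, le_max_right _ _, fun r hr => hR r ((le_max_left _ _).trans hr)⟩
  have hlarge : ∀ x ∈ K, ∀ q, R ≤ ‖q‖ → l q + k ≤ f x q := by
    intro x hx q hq
    have h1 : 1 ≤ ‖q‖ := hR1.trans hq
    have h2 := hR _ hq
    rw [div_le_iff₀ hα] at h2
    calc l q + k ≤ ‖l‖ * ‖q‖ + |k| * ‖q‖ := by
          have := (le_abs_self (l q)).trans (l.le_opNorm q)
          have := le_abs_self k
          have := le_mul_of_one_le_right (abs_nonneg k) h1
          linarith
      _ = (‖l‖ + |k|) * ‖q‖ := by ring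
      _ ≤ ‖q‖ ^ (θ - 1) * α * ‖q‖ := by gcongr
      _ = α * ‖q‖ ^ θ := by
          rw [Real.rpow_sub_one (by positivity)]
          field_simp
      _ ≤ f x q := hlb x hx q
  have hunif := (hK.prod (isCompact_closedBall (0 : E) R)).uniformContinuousOn_of_continuous
    (hf.mono (prod_mono_right (subset_univ _)))
  obtain ⟨δ, hδ, hδf⟩ := Metric.uniformContinuousOn_iff.1 hunif ε hεpos
  obtain ⟨N₀, hN₀⟩ := Metric.tendsto_atTop.1 hx δ hδ
  have hbelow : ∀ n ≥ N₀, ∀ q, l q + k - ε ≤ f (x n) q := by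
    intro n hn q
    rcases le_total R ‖q‖ with hq | hq
    · have := hlarge _ (hxK n) q hq
      linarith
    · have hq' : q ∈ Metric.closedBall (0 : E) R := by simpa using hq
      have h1 := hδf (x n, q) ⟨hxK n, hq'⟩ (y, q) ⟨hy, hq'⟩ (by
        rw [Prod.dist_eq]
        simpa [hδ] using hN₀ n hn)
      rw [Real.dist_eq, abs_lt] at h1
      have h2 := hle' q
      simp only at h1
      linarith [h1.1]
  have hlim : Tendsto (fun N => l (Finsupp.linearCombination ℝ p (c N)) + k - ε) atTop
      (𝓝 (a' - ε)) := by
    rw [← heq']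
    exact (((l.continuous.tendsto v).comp hv).add_const k).sub_const ε
  filter_upwards [hlim.eventually_const_lt (show a < a' - ε by rw [hε]; linarith),
    eventually_ge_atTop N₀] with N hN hNN₀
  refine hN.le.trans ?_
  have hsum := sum_eq_one_of_mem_tailWeights (hc N)
  simp only [Finsupp.linearCombination_apply, Finsupp.sum, map_sum, map_smul, smul_eq_mul]
  calc ∑ n ∈ (c N).support, c N n * l (p n) + k - ε
      = ∑ n ∈ (c N).support, c N n * (l (p n) + k - ε) := by
        simp only [add_sub_assoc, mul_add, Finset.sum_add_distrib, ← Finset.sum_mul, hsum, one_mul]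
    _ ≤ _ := by
        refine Finset.sum_le_sum fun n hn => mul_le_mul_of_nonneg_left ?_ ((hc N).1 n)
        exact hbelow n (hNN₀.trans (le_of_mem_support_of_mem_tailWeights (hc N) hn)) _

lemma ofReal_le_liminf_sum {E : Type*} [NormedAddCommGroup E] [NormedSpace ℝ E]
    [ProperSpace E] {K : Set E} (hK : IsCompact K) {f : E → E → ℝ}
    (hf : ContinuousOn (fun q : E × E => f q.1 q.2) (K ×ˢ univ)) {y : E} (hy : y ∈ K)
    (hconv : ConvexOn ℝ univ (f y)) {α θ : ℝ} (hα : 0 < α) (hθ : 1 < θ)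
    (hlb : ∀ x ∈ K, ∀ p, α * ‖p‖ ^ θ ≤ f x p) {x p : ℕ → E} (hxK : ∀ n, x n ∈ K)
    (hx : Tendsto x atTop (𝓝 y)) {c : ℕ → ℕ →₀ ℝ} (hc : ∀ N, c N ∈ tailWeights N) {v : E}
    (hv : Tendsto (fun N => Finsupp.linearCombination ℝ p (c N)) atTop (𝓝 v)) :
    ENNReal.ofReal (f y v) ≤ liminf (fun N => ∑ n ∈ (c N).support,
      ENNReal.ofReal (c N n) * ENNReal.ofReal (f (x n) (p n))) atTop := by
  refine le_of_forall_lt fun b hb => ?_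
  obtain ⟨b', hbb', hb'⟩ := exists_between hb
  refine hbb'.trans_le (le_liminf_of_le (by isBoundedDefault) ?_)
  have h := (ENNReal.lt_ofReal_iff_toReal_lt hb'.ne_top).1 hb'
  filter_upwards [eventually_le_linearCombination hK hf hy hconv hα hθ hlb hxK hx hc hv h]
    with N hN
  have hnn : ∀ n, 0 ≤ f (x n) (p n) := fun n =>
    (by positivity : 0 ≤ α * ‖p n‖ ^ θ).trans (hlb _ (hxK n) _)
  simp only [← ENNReal.ofReal_mul ((hc N).1 _)]
  rw [← ENNReal.ofReal_sum_of_nonneg fun n _ => mul_nonneg ((hc N).1 n) (hnn n)]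
  exact ENNReal.le_ofReal_iff_toReal_le hb'.ne_top
    (ENNReal.toReal_nonneg.trans hN) |>.2 (by
      simpa [Finsupp.linearCombination_apply, Finsupp.sum] using hN)

/-- Measurability of a Carathéodory integrand along a curve. -/
lemma aemeasurable_caratheodory_comp {A E : Type*} {mA : MeasurableSpace A} {ν : Measure A}
    [NormedAddCommGroup E] [SecondCountableTopology E] [MeasurableSpace E] [BorelSpace E]
    {K : Set E} {ℓ : A → E → E → ℝ} (hmeas : ∀ x p, Measurable fun t => ℓ t x p)
    (hcont : ∀ᵐ t ∂ν, ContinuousOn (fun q : E × E => ℓ t q.1 q.2) (K ×ˢ univ))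
    {γ : A → E} (hγ : Measurable γ) (hγK : ∀ t, γ t ∈ K) {g : A → E} (hg : AEMeasurable g ν) :
    AEMeasurable (fun t => ℓ t (γ t) (g t)) ν := by
  obtain ⟨s, hs, hsm, hνs⟩ := exists_measurable_superset_of_null (ae_iff.1 hcont)
  classical
  let u : K × E → A → ℝ := fun q t => if t ∈ s then 0 else ℓ t q.1 q.2
  have hu : Measurable (Function.uncurry u) := by
    refine measurable_uncurry_of_continuous_of_measurable (fun t => ?_) fun q => ?_
    · by_cases ht : t ∈ s
      · simp only [u, if_pos ht]
        exact continuous_const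
      · simp only [u, if_neg ht]
        have hct : ContinuousOn (fun q : E × E => ℓ t q.1 q.2) (K ×ˢ univ) := by
          by_contra h
          exact ht (hs h)
        exact hct.comp_continuous (by fun_prop : Continuous fun q : K × E => ((q.1 : E), q.2))
          fun q => ⟨q.1.2, mem_univ _⟩
    · exact Measurable.ite hsm measurable_const (hmeas _ _)
  have hcomp : Measurable fun t => Function.uncurry u ((⟨γ t, hγK t⟩, hg.mk g t), t) :=
    hu.comp (((hγ.subtype_mk).prodMk hg.measurable_mk).prodMk measurable_id)
  refine ⟨_, hcomp, ?_⟩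
  filter_upwards [hg.ae_eq_mk, measure_eq_zero_iff_ae_notMem.1 hνs] with t ht hts
  simp only [Function.uncurry, u, if_neg hts, ← ht]

/-- The finite measure `exp (-t) dt` on the positive half-line. -/
def expWeight : Measure ℝ :=
  (volume.restrict (Ioi (0 : ℝ))).withDensity fun t => ENNReal.ofReal (Real.exp (-t))

instance : IsFiniteMeasure expWeight :=
  isFiniteMeasure_withDensity_ofReal (integrableOn_exp_neg_Ioi 0).hasFiniteIntegral

lemma expWeight_le : expWeight ≤ volume.restrict (Ioi (0 : ℝ)) := by
  refine (withDensity_mono (g := 1) ?_).trans_eq withDensity_one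
  filter_upwards [ae_restrict_mem measurableSet_Ioi] with t ht
  rw [Pi.one_apply, ENNReal.ofReal_le_one, Real.exp_le_one_iff]
  exact neg_nonpos.2 (le_of_lt ht)

lemma absolutelyContinuous_expWeight : volume.restrict (Ioi (0 : ℝ)) ≪ expWeight :=
  withDensity_absolutelyContinuous' (by fun_prop)
    (ae_of_all _ fun t => (ENNReal.ofReal_pos.2 (Real.exp_pos _)).ne')

lemma restrict_Ioc_le_smul_expWeight (T : ℝ) :
    volume.restrict (Ioc 0 T) ≤ ENNReal.ofReal (Real.exp T) • expWeight := by
  refine Measure.le_iff.2 fun s hs => ?_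
  rw [Measure.smul_apply, smul_eq_mul, expWeight, withDensity_apply _ hs,
    Measure.restrict_restrict hs, Measure.restrict_apply hs, ← lintegral_const_mul' _ _
      ENNReal.ofReal_ne_top, ← setLIntegral_one]
  refine (setLIntegral_mono' (hs.inter measurableSet_Ioc) fun t ht => ?_).trans
    (lintegral_mono_set (inter_subset_inter_right s Ioc_subset_Ioi_self))
  rw [← ENNReal.ofReal_mul (Real.exp_pos T).le, ← Real.exp_add, ENNReal.one_le_ofReal,
    Real.one_le_exp_iff]
  linarith [ht.2.2]

/-- The integral part of `Lcost`. -/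
def runningCost {Ω : Set (EucSp d)} (ℓ : ℝ → EucSp d → EucSp d → ℝ) (γ : CurveSp Ω) : ℝ≥0∞ :=
  ⨅ (g : ℝ → EucSp d) (_ : HasVel γ g),
    ∫⁻ t in Set.Ioi (0 : ℝ), ENNReal.ofReal (ℓ t (γ.1 t.toNNReal) (g t))

lemma HasVel.aestronglyMeasurable {Ω : Set (EucSp d)} {γ : CurveSp Ω} {g : ℝ → EucSp d}
    (h : HasVel γ g) : AEStronglyMeasurable g (volume.restrict (Ioi 0)) := by
  have hU : Ioi (0 : ℝ) ⊆ ⋃ n : ℕ, Icc (0 : ℝ) n := fun t ht => by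
    obtain ⟨n, hn⟩ := exists_nat_ge t
    exact mem_iUnion.2 ⟨n, le_of_lt ht, hn⟩
  exact (aestronglyMeasurable_iUnion_iff.2 fun n : ℕ => (h.1 n).aestronglyMeasurable).mono_set hU

lemma exists_hasVel_of_runningCost_lt {Ω : Set (EucSp d)} {ℓ : ℝ → EucSp d → EucSp d → ℝ}
    {γ : CurveSp Ω} {r : ℝ≥0∞} (h : runningCost ℓ γ < r) :
    ∃ g, HasVel γ g ∧
      ∫⁻ t in Set.Ioi (0 : ℝ), ENNReal.ofReal (ℓ t (γ.1 t.toNNReal) (g t)) < r := by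
  simpa only [runningCost, iInf_lt_iff, exists_prop] using h

lemma lintegral_rpow_norm_le {Ω : Set (EucSp d)} {ℓ : ℝ → EucSp d → EucSp d → ℝ} {α θ : ℝ}
    (hα : 0 < α)
    (hℓlb : ∀ t ∈ Set.Ici (0 : ℝ), ∀ x ∈ closure Ω, ∀ p, α * ‖p‖ ^ θ ≤ ℓ t x p)
    (γ : CurveSp Ω) (g : ℝ → EucSp d) :
    ∫⁻ t in Ioi (0 : ℝ), ENNReal.ofReal (‖g t‖ ^ θ) ≤
      ENNReal.ofReal α⁻¹ *
        ∫⁻ t in Ioi (0 : ℝ), ENNReal.ofReal (ℓ t (γ.1 t.toNNReal) (g t)) := by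
  rw [← lintegral_const_mul' _ _ ENNReal.ofReal_ne_top]
  refine setLIntegral_mono' measurableSet_Ioi fun t ht => ?_
  rw [← ENNReal.ofReal_mul (inv_pos.2 hα).le]
  refine ENNReal.ofReal_le_ofReal ?_
  rw [inv_mul_eq_div, le_div_iff₀' hα]
  exact hℓlb t (mem_Ici.2 (mem_Ioi.1 ht).le) _ (γ.2 _) _

lemma HasVel.dist_le {Ω : Set (EucSp d)} {γ : CurveSp Ω} {g : ℝ → EucSp d} (h : HasVel γ g)
    {θ : ℝ} (hθ : 1 < θ) {C : ℝ≥0}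
    (hC : ∫⁻ t in Ioi (0 : ℝ), ENNReal.ofReal (‖g t‖ ^ θ) ≤ C) (s t : ℝ≥0) :
    dist (γ.1 s) (γ.1 t) ≤ (1 + C) * dist s t ^ (1 - 1 / θ) := by
  have hθ0 : 0 < θ := by linarith
  wlog hst : s ≤ t generalizing s t
  · rw [dist_comm, dist_comm s]
    exact this t s (le_of_not_ge hst)
  rcases hst.eq_or_lt with rfl | hlt
  · rw [dist_self]
    positivity
  set δ : ℝ := t - s with hδ
  have hδpos : 0 < δ := sub_pos.2 (by exact_mod_cast hlt)
  set M : ℝ := δ ^ (-(1 / θ)) with hM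
  have hMpos : 0 < M := Real.rpow_pos_of_pos hδpos _
  have hM1 : M * δ = δ ^ (1 - 1 / θ) := by
    rw [hM, ← Real.rpow_add_one hδpos.ne']
    ring_nf
  have hM2 : M ^ (1 - θ) = δ ^ (1 - 1 / θ) := by
    rw [hM, ← Real.rpow_mul hδpos.le]
    congr 1
    field_simp
    ring
  have hdist : dist s t = δ := by
    rw [NNReal.dist_eq, abs_sub_comm, abs_of_pos hδpos]
  have hs0 : (0 : ℝ) ≤ s := s.2
  have hst' : (s : ℝ) ≤ t := by exact_mod_cast hst
  have hdiff : γ.1 t - γ.1 s = ∫ u in Ioc (s : ℝ) t, g u := by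
    have hint : IntegrableOn g (Icc 0 (t : ℝ)) volume := h.1 t
    rw [h.2 t, h.2 s, ← Ioc_union_Ioc_eq_Ioc hs0 hst',
      setIntegral_union (Ioc_disjoint_Ioc_of_le le_rfl) measurableSet_Ioc
        (hint.mono_set fun u hu => ⟨hu.1.le, hu.2.trans hst'⟩)
        (hint.mono_set fun u hu => ⟨hs0.trans hu.1.le, hu.2⟩)]
    abel
  have hle : ∫⁻ u in Ioc (s : ℝ) t, ‖g u‖ₑ ≤
      ENNReal.ofReal ((1 + C) * δ ^ (1 - 1 / θ)) := by
    calc ∫⁻ u in Ioc (s : ℝ) t, ‖g u‖ₑ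
        ≤ ∫⁻ u in Ioc (s : ℝ) t,
            (ENNReal.ofReal M + ENNReal.ofReal (M ^ (1 - θ)) * ENNReal.ofReal (‖g u‖ ^ θ)) := by
          refine lintegral_mono fun u => ?_
          rw [← ofReal_norm, ← ENNReal.ofReal_mul (by positivity),
            ← ENNReal.ofReal_add hMpos.le (by positivity)]
          refine ENNReal.ofReal_le_ofReal ?_
          rcases le_or_gt ‖g u‖ M with hu | hu
          · have : 0 ≤ M ^ (1 - θ) * ‖g u‖ ^ θ := by positivity
            linarith
          · have := le_rpow_one_sub_mul_rpow hMpos hθ hu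
            linarith
      _ = ENNReal.ofReal M * ENNReal.ofReal δ + ENNReal.ofReal (M ^ (1 - θ)) *
            ∫⁻ u in Ioc (s : ℝ) t, ENNReal.ofReal (‖g u‖ ^ θ) := by
          rw [lintegral_add_left measurable_const, lintegral_const_mul' _ _ ENNReal.ofReal_ne_top,
            setLIntegral_const, Real.volume_Ioc]
      _ ≤ ENNReal.ofReal M * ENNReal.ofReal δ + ENNReal.ofReal (M ^ (1 - θ)) * C := by
          gcongr
          exact (lintegral_mono_set fun u hu => hs0.trans_lt hu.1).trans hC
      _ = ENNReal.ofReal ((1 + C) * δ ^ (1 - 1 / θ)) := by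
          rw [← ENNReal.ofReal_mul hMpos.le, hM1, hM2, ← ENNReal.ofReal_coe_nnreal (p := C),
            ← ENNReal.ofReal_mul (by positivity),
            ← ENNReal.ofReal_add (by positivity) (by positivity)]
          ring_nf
  rw [dist_comm, dist_eq_norm, hdist, hdiff]
  have := (enorm_integral_le_lintegral_enorm (μ := volume.restrict (Ioc (s : ℝ) t)) g).trans hle
  rw [← ofReal_norm] at this
  exact (ENNReal.ofReal_le_ofReal_iff (by positivity)).1 this

lemma isCompact_holderCurves {Ω : Set (EucSp d)} (hΩbd : Bornology.IsBounded Ω) (C : ℝ) {β : ℝ}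
    (hβ : 0 < β) :
    IsCompact {γ : CurveSp Ω | ∀ s t : ℝ≥0, dist (γ.1 s) (γ.1 t) ≤ C * dist s t ^ β} := by
  set S : Set C(ℝ≥0, EucSp d) := {f | (∀ t, f t ∈ closure Ω) ∧
    ∀ s t : ℝ≥0, dist (f s) (f t) ≤ C * dist s t ^ β} with hS
  have hlim : Tendsto (fun r : ℝ => C * r ^ β) (𝓝 0) (𝓝 0) := by
    have : ContinuousAt (fun r : ℝ => C * r ^ β) 0 :=
      continuousAt_const.mul (Real.continuousAt_rpow_const _ _ (Or.inr hβ.le))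
    simpa [ContinuousAt, Real.zero_rpow hβ.ne'] using this
  have himage : ContinuousMap.toFun '' S = {f : ℝ≥0 → EucSp d |
      (∀ t, f t ∈ closure Ω) ∧ ∀ s t : ℝ≥0, dist (f s) (f t) ≤ C * dist s t ^ β} := by
    ext f
    constructor
    · rintro ⟨φ, hφ, rfl⟩
      exact hφ
    · intro hf
      have hcont : Continuous f := by
        rw [continuous_iff_continuousAt]
        intro t
        refine tendsto_iff_dist_tendsto_zero.2 (squeeze_zero (fun _ => dist_nonneg)
          (fun s => hf.2 s t) (hlim.comp ?_))
        exact tendsto_iff_dist_tendsto_zero.1 tendsto_id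
      exact ⟨⟨f, hcont⟩, hf, rfl⟩
  have hScompact : IsCompact S := by
    refine ArzelaAscoli.isCompact_of_equicontinuous S ?_ ?_
    · rw [himage]
      refine (isCompact_univ_pi fun _ : ℝ≥0 => hΩbd.isCompact_closure).of_isClosed_subset ?_
        fun f hf t _ => hf.1 t
      simp only [ofPred_and, ofPred_forall]
      refine (isClosed_iInter fun t => isClosed_closure.preimage (continuous_apply t)).inter
        (isClosed_iInter fun s => isClosed_iInter fun t => ?_)
      exact isClosed_le ((continuous_apply s).dist (continuous_apply t)) continuous_const
    · exact Metric.equicontinuous_of_continuity_modulus _ hlim _ fun s t f => f.2.2 s t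
  rw [Subtype.isCompact_iff]
  convert hScompact using 1
  ext f
  constructor
  · rintro ⟨γ, hγ, rfl⟩
    exact ⟨γ.2, hγ⟩
  · rintro ⟨h1, h2⟩
    exact ⟨⟨f, h1⟩, h2, rfl⟩

lemma isClosed_runningCost_le {Ω : Set (EucSp d)} (hΩbd : Bornology.IsBounded Ω)
    {ℓ : ℝ → EucSp d → EucSp d → ℝ}
    (hℓmeas : ∀ x p, Measurable fun t : ℝ => ℓ t x p)
    (hℓcont : ∀ᵐ t ∂(volume.restrict (Set.Ioi (0 : ℝ))),
      ContinuousOn (fun q : EucSp d × EucSp d => ℓ t q.1 q.2)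
        ((closure Ω) ×ˢ (Set.univ : Set (EucSp d))))
    (hℓconv : ∀ᵐ t ∂(volume.restrict (Set.Ioi (0 : ℝ))), ∀ x ∈ closure Ω,
      ConvexOn ℝ Set.univ fun p => ℓ t x p)
    {α θ : ℝ} (hα : 0 < α) (hθ : 1 < θ)
    (hℓlb : ∀ t ∈ Set.Ici (0 : ℝ), ∀ x ∈ closure Ω, ∀ p, α * ‖p‖ ^ θ ≤ ℓ t x p) (r : ℝ≥0) :
    IsClosed {γ : CurveSp Ω | runningCost ℓ γ ≤ r} := by
  refine IsSeqClosed.isClosed fun γ γ' hγ hlim => ?_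
  have hpt : ∀ t : ℝ≥0, Tendsto (fun n => (γ n).1 t) atTop (𝓝 (γ'.1 t)) := fun t =>
    ((continuous_eval_const t).tendsto _).comp
      ((continuous_subtype_val.tendsto _).comp hlim)
  have hex : ∀ n : ℕ, ∃ g, HasVel (γ n) g ∧
      ∫⁻ t in Ioi (0 : ℝ), ENNReal.ofReal (ℓ t ((γ n).1 t.toNNReal) (g t)) <
        r + ENNReal.ofReal (1 / ((n : ℝ) + 1)) := fun n =>
    exists_hasVel_of_runningCost_lt <| (show runningCost ℓ (γ n) ≤ r from hγ n).trans_lt <|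
      ENNReal.lt_add_right ENNReal.coe_ne_top
        (ENNReal.ofReal_pos.2 Nat.one_div_pos_of_nat).ne'
  choose g hg hgr using hex
  have hgC : ∀ n, ∫⁻ t, ENNReal.ofReal (‖g n t‖ ^ θ) ∂expWeight ≤
      ((Real.toNNReal α⁻¹ * (r + 1) : ℝ≥0) : ℝ≥0∞) := by
    intro n
    refine (lintegral_mono' expWeight_le le_rfl).trans
      ((lintegral_rpow_norm_le hα hℓlb (γ n) (g n)).trans ?_)
    rw [ENNReal.coe_mul, ENNReal.coe_add, ENNReal.coe_one, ENNReal.ofReal]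
    gcongr
    refine (hgr n).le.trans ?_
    gcongr
    rw [ENNReal.ofReal_le_one, div_le_one (by positivity)]
    linarith [n.cast_nonneg (α := ℝ)]
  obtain ⟨c, v, hc, hvint, hgint, hae, hL1⟩ := exists_tailWeights_tendsto hθ
    (fun n => (hg n).aestronglyMeasurable.mono_measure expWeight_le) hgC
  have hres : ∀ {f : ℝ → EucSp d}, Integrable f expWeight → ∀ T, IntegrableOn f (Ioc 0 T) :=
    fun hf T => (hf.smul_measure ENNReal.ofReal_ne_top).mono_measure
      (restrict_Ioc_le_smul_expWeight T)
  have hvel : HasVel γ' v := by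
    refine ⟨fun T => (integrableOn_Icc_iff_integrableOn_Ioc (by simp)).2 (hres hvint T), fun t => ?_⟩
    have hcomb : ∀ N, Finsupp.linearCombination ℝ (fun n => (γ n).1 t - (γ n).1 0) (c N) =
        ∫ s in Ioc (0 : ℝ) t, Finsupp.linearCombination ℝ g (c N) s := by
      intro N
      have hint : ∀ n ∈ (c N).support,
          Integrable (fun s => c N n • g n s) (volume.restrict (Ioc 0 t)) :=
        fun n _ => (hres (hgint n) t).smul (c N n)
      simp only [Finsupp.linearCombination_apply, Finsupp.sum, Finset.sum_apply, Pi.smul_apply]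
      rw [integral_finsetSum _ hint]
      refine Finset.sum_congr rfl fun n _ => ?_
      rw [integral_smul, (hg n).2 t, add_sub_cancel_left]
    have hlim1 := tendsto_linearCombination_of_tailWeights hc ((hpt t).sub (hpt 0))
    have hlim2 : Tendsto (fun N => ∫ s in Ioc (0 : ℝ) t, Finsupp.linearCombination ℝ g (c N) s)
        atTop (𝓝 (∫ s in Ioc (0 : ℝ) t, v s)) := by
      refine tendsto_integral_of_L1 _ (hres hvint t).aestronglyMeasurable (Eventually.of_forall fun N => ?_) ?_
      · simp only [Finsupp.linearCombination_apply, Finsupp.sum]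
        exact integrable_finsetSum' _ fun n _ => (hres (hgint n) t).smul (c N n)
      · refine tendsto_of_tendsto_of_tendsto_of_le_of_le (h := fun N => ENNReal.ofReal (Real.exp t) *
            ∫⁻ s, ‖Finsupp.linearCombination ℝ g (c N) s - v s‖ₑ ∂expWeight)
          tendsto_const_nhds ?_ (fun _ => zero_le) fun N => ?_
        · simpa using ENNReal.Tendsto.const_mul hL1 (Or.inr ENNReal.ofReal_ne_top)
        · refine (lintegral_mono' (restrict_Ioc_le_smul_expWeight t) le_rfl).trans_eq ?_
          rw [lintegral_smul_measure, smul_eq_mul]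
    rw [← tendsto_nhds_unique hlim1 (hlim2.congr fun N => (hcomb N).symm)]
    abel
  have hmeasℓ : ∀ n, AEMeasurable
      (fun t => ENNReal.ofReal (ℓ t ((γ n).1 t.toNNReal) (g n t))) (volume.restrict (Ioi 0)) :=
    fun n => (aemeasurable_caratheodory_comp hℓmeas hℓcont
      (((γ n).1.continuous.comp continuous_real_toNNReal).measurable) (fun t => (γ n).2 _)
      (hg n).aestronglyMeasurable.aemeasurable).ennreal_ofReal
  have hupper : ∀ N, ∫⁻ t in Ioi (0 : ℝ), ∑ n ∈ (c N).support, ENNReal.ofReal (c N n) *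
      ENNReal.ofReal (ℓ t ((γ n).1 t.toNNReal) (g n t)) ≤
        r + ENNReal.ofReal (1 / ((N : ℝ) + 1)) := by
    intro N
    rw [lintegral_finsetSum' _ fun n _ => (hmeasℓ n).const_mul _]
    calc ∑ n ∈ (c N).support, ∫⁻ t in Ioi (0 : ℝ), ENNReal.ofReal (c N n) *
          ENNReal.ofReal (ℓ t ((γ n).1 t.toNNReal) (g n t))
        ≤ ∑ n ∈ (c N).support, ENNReal.ofReal (c N n) *
            (r + ENNReal.ofReal (1 / ((N : ℝ) + 1))) := by
          refine Finset.sum_le_sum fun n hn => ?_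
          rw [lintegral_const_mul' _ _ ENNReal.ofReal_ne_top]
          have := le_of_mem_support_of_mem_tailWeights (hc N) hn
          refine mul_le_mul_right ((hgr n).le.trans ?_) _
          gcongr
      _ = r + ENNReal.ofReal (1 / ((N : ℝ) + 1)) := by
          rw [← Finset.sum_mul, ← ENNReal.ofReal_sum_of_nonneg fun n _ => (hc N).1 n,
            sum_eq_one_of_mem_tailWeights (hc N), ENNReal.ofReal_one, one_mul]
  have hlimr : Tendsto (fun N : ℕ => (r : ℝ≥0∞) + ENNReal.ofReal (1 / ((N : ℝ) + 1))) atTop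
      (𝓝 r) := by
    simpa using tendsto_const_nhds.add
      (ENNReal.tendsto_ofReal tendsto_one_div_add_atTop_nhds_zero_nat)
  calc runningCost ℓ γ'
      ≤ ∫⁻ t in Ioi (0 : ℝ), ENNReal.ofReal (ℓ t (γ'.1 t.toNNReal) (v t)) :=
        iInf₂_le v hvel
    _ ≤ ∫⁻ t in Ioi (0 : ℝ), liminf (fun N => ∑ n ∈ (c N).support, ENNReal.ofReal (c N n) *
          ENNReal.ofReal (ℓ t ((γ n).1 t.toNNReal) (g n t))) atTop := by
        refine lintegral_mono_ae ?_
        filter_upwards [hℓcont, hℓconv, absolutelyContinuous_expWeight.ae_le hae,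
          ae_restrict_mem measurableSet_Ioi] with t hcont hconv ht ht0
        refine ofReal_le_liminf_sum hΩbd.isCompact_closure hcont (γ'.2 _) (hconv _ (γ'.2 _)) hα hθ
          (hℓlb t (mem_Ici.2 (mem_Ioi.1 ht0).le)) (fun n => (γ n).2 _) (hpt _) hc
          (p := fun n => g n t) ?_
        simpa only [Finsupp.linearCombination_apply, Finsupp.sum, Finset.sum_apply,
          Pi.smul_apply] using ht
    _ ≤ liminf (fun N => ∫⁻ t in Ioi (0 : ℝ), ∑ n ∈ (c N).support, ENNReal.ofReal (c N n) *
          ENNReal.ofReal (ℓ t ((γ n).1 t.toNNReal) (g n t))) atTop :=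
        lintegral_liminf_le' fun N => Finset.aemeasurable_fun_sum _ fun n _ =>
          (hmeasℓ n).const_mul _
    _ ≤ liminf (fun N : ℕ => (r : ℝ≥0∞) + ENNReal.ofReal (1 / ((N : ℝ) + 1))) atTop :=
        liminf_le_liminf (Eventually.of_forall hupper)
    _ = r := hlimr.liminf_eq

lemma lowerSemicontinuous_runningCost {Ω : Set (EucSp d)} {ℓ : ℝ → EucSp d → EucSp d → ℝ}
    (h : ∀ r : ℝ≥0, IsClosed {γ : CurveSp Ω | runningCost ℓ γ ≤ r}) :
    LowerSemicontinuous fun γ : CurveSp Ω => runningCost ℓ γ := by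
  refine lowerSemicontinuous_iff_isClosed_preimage.2 fun r => ?_
  induction r with
  | top => simp
  | coe r => exact h r

lemma lowerSemicontinuous_PsiExt_exitT {Ω : Set (EucSp d)} {Ξ : Set (EucSp d)}
    (hΞcl : IsClosed Ξ) {Ψ : ℝ → ℝ} (hΨlsc : LowerSemicontinuousOn Ψ (Set.Ici 0)) :
    LowerSemicontinuous fun γ : CurveSp Ω => PsiExt Ψ (exitT Ξ γ) := by
  intro γ y hy
  simp only [PsiExt, lt_iSup_iff] at hy
  obtain ⟨t, ht, hyt⟩ := hy
  rcases eq_or_ne t 0 with rfl | ht0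
  · refine Eventually.of_forall fun γ' => hyt.trans_le ?_
    exact le_iSup₂_of_le 0 (by simp) le_rfl
  obtain ⟨s, hst, hys⟩ : ∃ s : ℝ≥0, s < t ∧ y < ENNReal.ofReal (Ψ s) := by
    have h1 := hΨlsc t (mem_Ici.2 t.2) y.toReal
      ((ENNReal.lt_ofReal_iff_toReal_lt hyt.ne_top).1 hyt)
    have hcont : Tendsto ((↑) : ℝ≥0 → ℝ) (𝓝[<] t) (𝓝[Ici 0] (t : ℝ)) :=
      tendsto_nhdsWithin_iff.2 ⟨(NNReal.continuous_coe.tendsto t).mono_left nhdsWithin_le_nhds,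
        Eventually.of_forall fun s => mem_Ici.2 s.2⟩
    have : (𝓝[<] t).NeBot := nhdsLT_neBot_of_exists_lt ⟨0, pos_iff_ne_zero.2 ht0⟩
    obtain ⟨s, hs, hst⟩ := ((hcont.eventually h1).and self_mem_nhdsWithin).exists
    exact ⟨s, hst, (ENNReal.lt_ofReal_iff_toReal_lt hyt.ne_top).2 hs⟩
  have hmaps : MapsTo γ.1 (Icc 0 s) Ξᶜ := by
    intro u hu hΞ
    have h1 : (t : ℝ≥0∞) ≤ u := ht.trans (iInf₂_le u hΞ)
    exact absurd (hu.2.trans_lt hst) (not_lt.2 (by exact_mod_cast h1))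
  have hev := (continuous_subtype_val.tendsto γ).eventually
    (ContinuousMap.eventually_mapsTo isCompact_Icc hΞcl.isOpen_compl hmaps)
  filter_upwards [hev] with γ' hγ'
  refine hys.trans_le (le_iSup₂_of_le s (le_iInf₂ fun u hu => ?_) le_rfl)
  by_contra! h
  exact hγ' ⟨zero_le, by exact_mod_cast h.le⟩ hu

/-- Corollary `coro:compactness`: under (H1), (H2), (H3), (H5), the sublevel sets of `L` are compact in `Γ`. -/
theorem Lcost_sublevels_compact {d : ℕ}
    (Ω : Set (EucSp d)) (hΩne : Ω.Nonempty) (hΩop : IsOpen Ω)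
    (hΩbd : Bornology.IsBounded Ω)
    (Ξ : Set (EucSp d)) (hΞne : Ξ.Nonempty) (hΞcl : IsClosed Ξ) (hΞsub : Ξ ⊆ closure Ω)
    (ℓ : ℝ → EucSp d → EucSp d → ℝ)
    (hℓmeas : ∀ x p, Measurable fun t : ℝ => ℓ t x p)
    (hℓcont : ∀ᵐ t ∂(volume.restrict (Set.Ioi (0 : ℝ))),
      ContinuousOn (fun q : EucSp d × EucSp d => ℓ t q.1 q.2)
        ((closure Ω) ×ˢ (Set.univ : Set (EucSp d))))
    (hℓconv : ∀ᵐ t ∂(volume.restrict (Set.Ioi (0 : ℝ))), ∀ x ∈ closure Ω,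
      ConvexOn ℝ Set.univ fun p => ℓ t x p)
    (hℓnn : ∀ t ∈ Set.Ici (0 : ℝ), ∀ x ∈ closure Ω, ∀ p, 0 ≤ ℓ t x p)
    (α θ : ℝ) (hα : 0 < α) (hθ : 1 < θ)
    (hℓlb : ∀ t ∈ Set.Ici (0 : ℝ), ∀ x ∈ closure Ω, ∀ p, α * ‖p‖ ^ θ ≤ ℓ t x p)
    (Ψ : ℝ → ℝ) (hΨnn : ∀ t ∈ Set.Ici (0 : ℝ), 0 ≤ Ψ t)
    (hΨlsc : LowerSemicontinuousOn Ψ (Set.Ici 0)) (hΨmono : MonotoneOn Ψ (Set.Ici 0))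
    (a b : ℝ) (ha : 0 < a) (hb : 0 < b)
    (hΨlb : ∀ t ∈ Set.Ici (0 : ℝ), a * t - b ≤ Ψ t) :
    ∀ c : ℝ, 0 < c → IsCompact {γ : CurveSp Ω | Lcost ℓ Ψ Ξ γ ≤ ENNReal.ofReal c} := by
  intro c _
  have hrun := lowerSemicontinuous_runningCost
    (isClosed_runningCost_le hΩbd hℓmeas hℓcont hℓconv hα hθ hℓlb)
  have hclosed : IsClosed {γ : CurveSp Ω | Lcost ℓ Ψ Ξ γ ≤ ENNReal.ofReal c} :=
    (hrun.add (lowerSemicontinuous_PsiExt_exitT hΞcl hΨlsc)).isClosed_preimage _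
  set C : ℝ≥0 := Real.toNNReal α⁻¹ * (Real.toNNReal c + 1) with hC
  refine (isCompact_holderCurves hΩbd (1 + C)
    (sub_pos.2 ((div_lt_one (by linarith)).2 hθ) : 0 < 1 - 1 / θ)).of_isClosed_subset hclosed
    fun γ hγ => ?_
  obtain ⟨g, hg, hgc⟩ := exists_hasVel_of_runningCost_lt (ℓ := ℓ) (γ := γ)
    (r := ENNReal.ofReal c + 1)
    ((le_self_add.trans hγ).trans_lt (ENNReal.lt_add_right ENNReal.ofReal_ne_top one_ne_zero))
  refine hg.dist_le hθ ((lintegral_rpow_norm_le hα hℓlb γ g).trans ?_)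
  rw [hC, ENNReal.coe_mul, ENNReal.coe_add, ENNReal.coe_one]
  exact mul_le_mul_right hgc.le _

end
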